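/- arXiv:2305.05064 — 7 statements merged into one kernel-verified Lean document; each statement's English description precedes it below -/
import Mathlib

section
/- Let ≺ be a predicate-based literal ordering and let C be a Horn clause. If C contains a positive literal L and L is ≺-maximal in C, then L is strictly ≺-maximal in C. -/
/-!
STATEMENT 0: Let ≺ be a predicate-based literal ordering and let C be a Horn clause.
If C contains a positive literal L and L is ≺-maximal in C, then L is strictly
≺-maximal in C.
-/

namespace Stmt0

/-- A literal: polarity (`true` = positive), predicate symbol, argument list. -/
abbrev Lit (Pred V : Type) := Bool × Pred × List V

/-- A ground literal: polarity, predicate symbol, ground arguments from the universe. -/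
abbrev GLit (Pred U : Type) := Bool × Pred × List U

variable {Pred V U : Type}

/-- The predicate-based order on ground literals generated from the order `precP` on
predicate symbols and the order `precU` on the universe: predicates are compared
first, then polarity (a positive literal is smaller than a negative one over the
same predicate, independent of the arguments), and finally the arguments are
compared lexicographically by `precU`. -/
def litLt (precP : Pred → Pred → Prop) (precU : U → U → Prop) :
    GLit Pred U → GLit Pred U → Prop := fun L L' =>
  precP L.2.1 L'.2.1 ∨
    (L.2.1 = L'.2.1 ∧
      ((L.1 = true ∧ L'.1 = false) ∨ (L.1 = L'.1 ∧ List.Lex precU L.2.2 L'.2.2)))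

/-- The reflexive closure ⪯ of the literal order. -/
def litLe (precP : Pred → Pred → Prop) (precU : U → U → Prop)
    (L L' : GLit Pred U) : Prop := litLt precP precU L L' ∨ L = L'

/-- The ground instance of a literal under the grounding substitution `β`. -/
def glit (L : Lit Pred V) (β : V → U) : GLit Pred U := (L.1, L.2.1, L.2.2.map β)

/-- A clause (disjunction of literals, represented as a list) is Horn if it contains
at most one positive literal. -/
def Horn (C : List (Lit Pred V)) : Prop := C.countP (fun L => L.1) ≤ 1

/-- In a list with at most one element satisfying `p`, any two positions whose entries satisfy
`p` coincide. -/
theorem index_eq_of_countP_le_one {α : Type*} {p : α → Bool} {l : List α}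
    (h : l.countP p ≤ 1) {i j : ℕ} (hi : i < l.length) (hj : j < l.length)
    (hpi : p l[i] = true) (hpj : p l[j] = true) : i = j := by
  induction l generalizing i j with
  | nil => simp at hi
  | cons a l ih =>
    have hpos {k : ℕ} (hk : k < l.length) (hpk : p l[k] = true) : 0 < l.countP p :=
      List.countP_pos_iff.2 ⟨_, List.getElem_mem hk, hpk⟩
    rw [List.countP_cons] at h
    cases i <;> cases j <;>
      simp only [List.getElem_cons_zero, List.getElem_cons_succ, List.length_cons,
        Nat.add_lt_add_iff_right] at hi hj hpi hpj
    · rfl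
    · have := hpos hj hpj
      simp only [hpi, if_true] at h
      omega
    · have := hpos hi hpi
      simp only [hpj, if_true] at h
      omega
    · exact congrArg Nat.succ (ih (by omega) hi hj hpi hpj)

theorem positive_maximal_is_strictly_maximal
    (precP : Pred → Pred → Prop) (precU : U → U → Prop)
    -- ≺ is generated from total, well-founded, strict orders on predicates and on U
    (hwfP : WellFounded precP) (hwfU : WellFounded precU)
    (htotP : ∀ a b : Pred, precP a b ∨ a = b ∨ precP b a)
    (htotU : ∀ a b : U, precU a b ∨ a = b ∨ precU b a)
    -- C is a Horn clause
    (C : List (Lit Pred V)) (hHorn : Horn C)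
    -- L (the i-th literal of C) is a positive literal of C
    (i : ℕ) (hi : i < C.length) (hpos : (C.get ⟨i, hi⟩).1 = true)
    -- L is ≺-maximal in C: for some grounding substitution β, no different literal
    -- L' of C satisfies Lβ ≺ L'β
    (hmax : ∃ β : V → U, ∀ j, (hj : j < C.length) → j ≠ i →
      ¬ litLt precP precU (glit (C.get ⟨i, hi⟩) β) (glit (C.get ⟨j, hj⟩) β)) :
    -- then L is strictly ≺-maximal in C: for some grounding substitution β,
    -- no different literal L' of C satisfies Lβ ⪯ L'β
    ∃ β : V → U, ∀ j, (hj : j < C.length) → j ≠ i →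
      ¬ litLe precP precU (glit (C.get ⟨i, hi⟩) β) (glit (C.get ⟨j, hj⟩) β) := by
  obtain ⟨β, hβ⟩ := hmax
  refine ⟨β, fun j hj hji hle => hle.elim (hβ j hj hji) fun heq => hji ?_⟩
  have hpol : (C.get ⟨i, hi⟩).1 = (C.get ⟨j, hj⟩).1 := (Prod.ext_iff.1 heq).1
  exact index_eq_of_countP_le_one hHorn hj hi (hpol.symm.trans hpos) hpos

end Stmt0
end

section
/- Let Λ‖C be a constrained Horn clause with C = C' ∨ P(y⃗) and C' ≺ P(y⃗), and let τ be a grounding substitution for Λ‖C. If S_{≺P} ⊭ (Λ‖C)τ, then Λτ is valid and S_{⪯P} ⊨ P(y⃗)τ; consequently S_{⪯P} ⊨ (Λ‖C)τ. -/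
/-!
STATEMENT 2: Let Λ‖C be a constrained Horn clause with C = C′ ∨ P(y⃗) and
C′ ≺ P(y⃗), and let τ be a grounding substitution for Λ‖C.  If S_{≺P} ⊭ (Λ‖C)τ,
then Λτ is valid and S_{⪯P} ⊨ P(y⃗)τ; consequently S_{⪯P} ⊨ (Λ‖C)τ.
-/

namespace Stmt2

/-- An interpretation assigns to each predicate symbol a set of argument tuples over
the universe `U`.  A symbolic interpretation S (an LA formula P^S(x⃗) for each
predicate) is identified with its corresponding interpretation I_S, i.e. it is
represented by the solution sets of the formulas P^S. -/
abbrev Interp (Pred U : Type) := Pred → List U → Prop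

/-- A constrained Horn clause Λ‖C: a constraint Λ (a multiset of LA atoms,
represented semantically by its truth value under every assignment β : V → U),
a body of negative first-order literals ¬P₁(y⃗₁) ∨ … ∨ ¬P_m(y⃗_m) and an optional
positive head literal P(y⃗); all first-order arguments are variables. -/
structure HClause (Pred V U : Type) where
  constraint : (V → U) → Prop
  body : List (Pred × List V)
  head : Option (Pred × List V)

/-- A ground literal: polarity (`true` = positive), predicate, ground arguments. -/
abbrev GLit (Pred U : Type) := Bool × Pred × List U

variable {Pred V U : Type}

/-- The predicate-based order on ground literals generated from the order `precP`
on predicate symbols and the order `precU` on the universe: predicates are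
compared first, then polarity (positive smaller than negative over the same
predicate, independent of arguments), then arguments lexicographically. -/
def litLt (precP : Pred → Pred → Prop) (precU : U → U → Prop) :
    GLit Pred U → GLit Pred U → Prop := fun L L' =>
  precP L.2.1 L'.2.1 ∨
    (L.2.1 = L'.2.1 ∧
      ((L.1 = true ∧ L'.1 = false) ∨ (L.1 = L'.1 ∧ List.Lex precU L.2.2 L'.2.2)))

/-- The (non-ground) literals of a Horn clause. -/
def lits (cl : HClause Pred V U) : List (Bool × Pred × List V) :=
  cl.body.map (fun b => (false, b.1, b.2)) ++
    (cl.head.map (fun h => (true, h.1, h.2))).toList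

/-- The ground instance of a literal under the grounding substitution `β`. -/
def glit (L : Bool × Pred × List V) (β : V → U) : GLit Pred U :=
  (L.1, L.2.1, L.2.2.map β)

/-- Satisfaction of the ground instance (Λ‖C)β by the interpretation `I`:
if the constraint is true under β then some ground literal of Cβ is true in `I`. -/
def satg (I : Interp Pred U) (cl : HClause Pred V U) (β : V → U) : Prop :=
  cl.constraint β →
    ((∃ b ∈ cl.body, ¬ I b.1 (b.2.map β)) ∨
      (∃ h, cl.head = some h ∧ I h.1 (h.2.map β)))

/-- I ⊨ Λ‖C : all ground instances are satisfied. -/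
def sat (I : Interp Pred U) (cl : HClause Pred V U) : Prop := ∀ β, satg I cl β

/-- The literal L is ≺-maximal in the clause: there is a grounding substitution β
such that no different literal L' of the clause satisfies Lβ ≺ L'β. -/
def maximalIn (precP : Pred → Pred → Prop) (precU : U → U → Prop)
    (L : Bool × Pred × List V) (cl : HClause Pred V U) : Prop :=
  L ∈ lits cl ∧ ∃ β : V → U, ∀ L' ∈ lits cl, L' ≠ L →
    ¬ litLt precP precU (glit L β) (glit L' β)

/-- The predicate P is ≺-maximal in the clause: some literal [¬]P(∗) of the clause
is ≺-maximal in it. -/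
def predMaximalIn (precP : Pred → Pred → Prop) (precU : U → U → Prop)
    (P : Pred) (cl : HClause Pred V U) : Prop :=
  ∃ L, L.2.1 = P ∧ maximalIn precP precU L cl

/-- The positive head literal P(y⃗) is ≺-maximal in the clause. -/
def headMaximal (precP : Pred → Pred → Prop) (precU : U → U → Prop)
    (cl : HClause Pred V U) : Prop :=
  ∃ h, cl.head = some h ∧ maximalIn precP precU (true, h.1, h.2) cl

/-- The operator δ(S, Λ‖C'∨P(y⃗)): it interprets the head predicate P by the
solution set of the formula (π({y⃗}, ⋀_{λ∈Λ} λ ∧ ⋀_i (P_i^S)σ_i))σ ∧ ⋎(y⃗,x⃗),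
i.e. by the set of all tuples y⃗τ where the assignment τ solves Λ and makes every
body atom P_i(y⃗_i) true in S; every other predicate is interpreted as ⊥. -/
def deltaOp (S : Interp Pred U) (cl : HClause Pred V U) : Interp Pred U :=
  fun Q as =>
    ∃ h, cl.head = some h ∧ h.1 = Q ∧
      ∃ τ : V → U, h.2.map τ = as ∧ cl.constraint τ ∧
        ∀ b ∈ cl.body, S b.1 (b.2.map τ)

/-- A negative literal below a positive one has a smaller predicate. -/
theorem litLt_neg_pos {precP : Pred → Pred → Prop} {precU : U → U → Prop}
    {Q P : Pred} {as bs : List U}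
    (h : litLt precP precU (false, Q, as) (true, P, bs)) : precP Q P := by
  simpa [litLt] using h

/-- A head that is above every body literal, under some grounding, is maximal. -/
theorem headMaximal_of_body_lt {precP : Pred → Pred → Prop} {precU : U → U → Prop}
    (hwfP : WellFounded precP) {cl : HClause Pred V U} {P : Pred} {ys : List V}
    (hhead : cl.head = some (P, ys)) (β : V → U)
    (hlt : ∀ b ∈ cl.body, litLt precP precU (false, b.1, b.2.map β) (true, P, ys.map β)) :
    headMaximal precP precU cl := by
  refine ⟨(P, ys), hhead, by simp [lits, hhead], β, fun L' hL' hne hL => ?_⟩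
  simp only [lits, hhead, Option.map_some, Option.toList_some, List.mem_append, List.mem_map,
    List.mem_singleton] at hL'
  rcases hL' with ⟨b, hb, rfl⟩ | rfl
  · have hbP := litLt_neg_pos (hlt b hb)
    rcases hL with hPb | ⟨hPb, -⟩
    · exact hwfP.asymmetric _ _ hbP hPb
    · change P = b.1 at hPb
      rw [← hPb] at hbP
      exact hwfP.asymmetric _ _ hbP hbP
  · exact hne rfl

theorem produces
    (precP : Pred → Pred → Prop) (precU : U → U → Prop)
    -- ≺ is generated from total, well-founded, strict orders on predicates and on U
    (hwfP : WellFounded precP) (hwfU : WellFounded precU)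
    (htotP : ∀ a b : Pred, precP a b ∨ a = b ∨ precP b a)
    (htotU : ∀ a b : U, precU a b ∨ a = b ∨ precU b a)
    -- N is a set of constrained Horn clauses
    (N : Set (HClause Pred V U))
    -- the model construction: S_{≺P}, S_{⪯P}, Δ_P and Δ_P^{Λ‖C},
    -- defined by mutual induction over ≺
    (SltP SleP Delta : Pred → Interp Pred U)
    (DeltaC : HClause Pred V U → Interp Pred U)
    -- S_{≺P} = ⋃_{Q ≺ P} Δ_Q
    (hSlt : ∀ P Q as, SltP P Q as ↔ ∃ R, precP R P ∧ Delta R Q as)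
    -- S_{⪯P} = S_{≺P} ∪ Δ_P
    (hSle : ∀ P Q as, SleP P Q as ↔ (SltP P Q as ∨ Delta P Q as))
    -- Δ_P = ⋃_{Λ‖C'∨P(∗) ∈ N} Δ_P^{Λ‖C'∨P(∗)}
    (hDelta : ∀ P Q as, Delta P Q as ↔
      ∃ cl ∈ N, (∃ ys, cl.head = some (P, ys)) ∧ DeltaC cl Q as)
    -- Δ_P^{Λ‖C} = δ(S_{≺P}, Λ‖C) if P(y⃗) is maximal in C and S_{≺P} ⊭ Λ‖C ...
    (hDeltaCpos : ∀ cl P ys, cl.head = some (P, ys) →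
      headMaximal precP precU cl → ¬ sat (SltP P) cl →
      DeltaC cl = deltaOp (SltP P) cl)
    -- ... and Δ_P^{Λ‖C} is the bottom symbolic interpretation otherwise
    (hDeltaCbot : ∀ cl,
      (∀ P ys, cl.head = some (P, ys) →
        ¬ (headMaximal precP precU cl ∧ ¬ sat (SltP P) cl)) →
      ∀ Q as, ¬ DeltaC cl Q as)
    -- Λ‖C ∈ N with C = C′ ∨ P(y⃗)
    (cl : HClause Pred V U) (hclN : cl ∈ N)
    (P : Pred) (ys : List V) (hhead : cl.head = some (P, ys))
    -- C′ ≺ P(y⃗): every literal of C′ is ≺-smaller than P(y⃗)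
    (hbody_lt : ∀ (β : V → U), ∀ b ∈ cl.body,
      litLt precP precU (false, b.1, b.2.map β) (true, P, ys.map β))
    -- τ is a grounding substitution for Λ‖C with S_{≺P} ⊭ (Λ‖C)τ
    (τ : V → U) (hτ : ¬ satg (SltP P) cl τ) :
    -- then Λτ is valid, S_{⪯P} ⊨ P(y⃗)τ, and thus S_{⪯P} ⊨ (Λ‖C)τ
    cl.constraint τ ∧ SleP P P (ys.map τ) ∧ satg (SleP P) cl τ := by
  have hmax := headMaximal_of_body_lt hwfP hhead τ (hbody_lt τ)
  have hnsat : ¬ sat (SltP P) cl := fun h => hτ (h τ)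
  simp only [satg, Classical.not_imp, not_or, not_exists, not_and, not_not] at hτ
  obtain ⟨hc, hb, -⟩ := hτ
  have hP : SleP P P (ys.map τ) := by
    refine (hSle _ _ _).2 (Or.inr ((hDelta _ _ _).2 ⟨cl, hclN, ⟨ys, hhead⟩, ?_⟩))
    rw [hDeltaCpos cl P ys hhead hmax hnsat]
    exact ⟨(P, ys), hhead, rfl, τ, rfl, hc, hb⟩
  exact ⟨hc, hP, fun _ => Or.inr ⟨(P, ys), hhead, hP⟩⟩

end Stmt2
end

section
/- If S_{⪯P} ⊨ P(a⃗) for a ground atom P(a⃗), then there exists a constrained Horn clause Λ‖C ∈ N with C = C' ∨ P(y⃗) and C' ≺ P(y⃗), and a grounding substitution τ for Λ‖C, such that P(a⃗) = P(y⃗)τ and S_{≺P} ⊭ (Λ‖C)τ. -/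
/-!
STATEMENT 3: If S_{⪯P} ⊨ P(a⃗) for a ground atom P(a⃗), then there exists a
constrained Horn clause Λ‖C ∈ N with C = C′ ∨ P(y⃗) and C′ ≺ P(y⃗), and a grounding
substitution τ for Λ‖C, such that P(a⃗) = P(y⃗)τ and S_{≺P} ⊭ (Λ‖C)τ.
-/

namespace Stmt3

/-- An interpretation assigns to each predicate symbol a set of argument tuples over
the universe `U`.  A symbolic interpretation S (an LA formula P^S(x⃗) for each
predicate) is identified with its corresponding interpretation I_S, i.e. it is
represented by the solution sets of the formulas P^S. -/
abbrev Interp (Pred U : Type) := Pred → List U → Prop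

/-- A constrained Horn clause Λ‖C: a constraint Λ (a multiset of LA atoms,
represented semantically by its truth value under every assignment β : V → U),
a body of negative first-order literals ¬P₁(y⃗₁) ∨ … ∨ ¬P_m(y⃗_m) and an optional
positive head literal P(y⃗); all first-order arguments are variables. -/
structure HClause (Pred V U : Type) where
  constraint : (V → U) → Prop
  body : List (Pred × List V)
  head : Option (Pred × List V)

/-- A ground literal: polarity (`true` = positive), predicate, ground arguments. -/
abbrev GLit (Pred U : Type) := Bool × Pred × List U

variable {Pred V U : Type}

/-- The predicate-based order on ground literals generated from the order `precP`
on predicate symbols and the order `precU` on the universe: predicates are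
compared first, then polarity (positive smaller than negative over the same
predicate, independent of arguments), then arguments lexicographically. -/
def litLt (precP : Pred → Pred → Prop) (precU : U → U → Prop) :
    GLit Pred U → GLit Pred U → Prop := fun L L' =>
  precP L.2.1 L'.2.1 ∨
    (L.2.1 = L'.2.1 ∧
      ((L.1 = true ∧ L'.1 = false) ∨ (L.1 = L'.1 ∧ List.Lex precU L.2.2 L'.2.2)))

/-- The (non-ground) literals of a Horn clause. -/
def lits (cl : HClause Pred V U) : List (Bool × Pred × List V) :=
  cl.body.map (fun b => (false, b.1, b.2)) ++
    (cl.head.map (fun h => (true, h.1, h.2))).toList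

/-- The ground instance of a literal under the grounding substitution `β`. -/
def glit (L : Bool × Pred × List V) (β : V → U) : GLit Pred U :=
  (L.1, L.2.1, L.2.2.map β)

/-- Satisfaction of the ground instance (Λ‖C)β by the interpretation `I`:
if the constraint is true under β then some ground literal of Cβ is true in `I`. -/
def satg (I : Interp Pred U) (cl : HClause Pred V U) (β : V → U) : Prop :=
  cl.constraint β →
    ((∃ b ∈ cl.body, ¬ I b.1 (b.2.map β)) ∨
      (∃ h, cl.head = some h ∧ I h.1 (h.2.map β)))

/-- I ⊨ Λ‖C : all ground instances are satisfied. -/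
def sat (I : Interp Pred U) (cl : HClause Pred V U) : Prop := ∀ β, satg I cl β

/-- The literal L is ≺-maximal in the clause: there is a grounding substitution β
such that no different literal L' of the clause satisfies Lβ ≺ L'β. -/
def maximalIn (precP : Pred → Pred → Prop) (precU : U → U → Prop)
    (L : Bool × Pred × List V) (cl : HClause Pred V U) : Prop :=
  L ∈ lits cl ∧ ∃ β : V → U, ∀ L' ∈ lits cl, L' ≠ L →
    ¬ litLt precP precU (glit L β) (glit L' β)

/-- The predicate P is ≺-maximal in the clause: some literal [¬]P(∗) of the clause
is ≺-maximal in it. -/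
def predMaximalIn (precP : Pred → Pred → Prop) (precU : U → U → Prop)
    (P : Pred) (cl : HClause Pred V U) : Prop :=
  ∃ L, L.2.1 = P ∧ maximalIn precP precU L cl

/-- The positive head literal P(y⃗) is ≺-maximal in the clause. -/
def headMaximal (precP : Pred → Pred → Prop) (precU : U → U → Prop)
    (cl : HClause Pred V U) : Prop :=
  ∃ h, cl.head = some h ∧ maximalIn precP precU (true, h.1, h.2) cl

/-- The operator δ(S, Λ‖C'∨P(y⃗)): it interprets the head predicate P by the
solution set of the formula (π({y⃗}, ⋀_{λ∈Λ} λ ∧ ⋀_i (P_i^S)σ_i))σ ∧ ⋎(y⃗,x⃗),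
i.e. by the set of all tuples y⃗τ where the assignment τ solves Λ and makes every
body atom P_i(y⃗_i) true in S; every other predicate is interpreted as ⊥. -/
def deltaOp (S : Interp Pred U) (cl : HClause Pred V U) : Interp Pred U :=
  fun Q as =>
    ∃ h, cl.head = some h ∧ h.1 = Q ∧
      ∃ τ : V → U, h.2.map τ = as ∧ cl.constraint τ ∧
        ∀ b ∈ cl.body, S b.1 (b.2.map τ)

/-- If the head of a clause is maximal in it, every body predicate precedes the head predicate. -/
lemma precP_of_headMaximal {precP : Pred → Pred → Prop} {precU : U → U → Prop}
    (htotP : ∀ a b : Pred, precP a b ∨ a = b ∨ precP b a)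
    {cl : HClause Pred V U} {P : Pred} {ys : List V} (hhead : cl.head = some (P, ys))
    (hmax : headMaximal precP precU cl) {b : Pred × List V} (hb : b ∈ cl.body) :
    precP b.1 P := by
  obtain ⟨h, hh, -, β, hβ⟩ := hmax
  obtain rfl : h = (P, ys) := Option.some.inj (hh.symm.trans hhead)
  have hnot := hβ (false, b.1, b.2)
    (List.mem_append_left _ (List.mem_map.2 ⟨b, hb, rfl⟩)) (by simp)
  rcases htotP b.1 P with hlt | heq | hgt
  · exact hlt
  · exact absurd (Or.inr ⟨heq.symm, Or.inl ⟨rfl, rfl⟩⟩) hnot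
  · exact absurd (Or.inl hgt) hnot

theorem producer
    (precP : Pred → Pred → Prop) (precU : U → U → Prop)
    -- ≺ is generated from total, well-founded, strict orders on predicates and on U
    (hwfP : WellFounded precP) (hwfU : WellFounded precU)
    (htotP : ∀ a b : Pred, precP a b ∨ a = b ∨ precP b a)
    (htotU : ∀ a b : U, precU a b ∨ a = b ∨ precU b a)
    -- N is a set of constrained Horn clauses
    (N : Set (HClause Pred V U))
    -- the model construction: S_{≺P}, S_{⪯P}, Δ_P and Δ_P^{Λ‖C},
    -- defined by mutual induction over ≺
    (SltP SleP Delta : Pred → Interp Pred U)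
    (DeltaC : HClause Pred V U → Interp Pred U)
    -- S_{≺P} = ⋃_{Q ≺ P} Δ_Q
    (hSlt : ∀ P Q as, SltP P Q as ↔ ∃ R, precP R P ∧ Delta R Q as)
    -- S_{⪯P} = S_{≺P} ∪ Δ_P
    (hSle : ∀ P Q as, SleP P Q as ↔ (SltP P Q as ∨ Delta P Q as))
    -- Δ_P = ⋃_{Λ‖C'∨P(∗) ∈ N} Δ_P^{Λ‖C'∨P(∗)}
    (hDelta : ∀ P Q as, Delta P Q as ↔
      ∃ cl ∈ N, (∃ ys, cl.head = some (P, ys)) ∧ DeltaC cl Q as)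
    -- Δ_P^{Λ‖C} = δ(S_{≺P}, Λ‖C) if P(y⃗) is maximal in C and S_{≺P} ⊭ Λ‖C ...
    (hDeltaCpos : ∀ cl P ys, cl.head = some (P, ys) →
      headMaximal precP precU cl → ¬ sat (SltP P) cl →
      DeltaC cl = deltaOp (SltP P) cl)
    -- ... and Δ_P^{Λ‖C} is the bottom symbolic interpretation otherwise
    (hDeltaCbot : ∀ cl,
      (∀ P ys, cl.head = some (P, ys) →
        ¬ (headMaximal precP precU cl ∧ ¬ sat (SltP P) cl)) →
      ∀ Q as, ¬ DeltaC cl Q as)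
    -- a ground atom P(a⃗) with S_{⪯P} ⊨ P(a⃗)
    (P : Pred) (as : List U) (h : SleP P P as) :
    -- then some clause Λ‖C ∈ N with C = C′ ∨ P(y⃗), C′ ≺ P(y⃗), and grounding τ
    -- satisfies P(a⃗) = P(y⃗)τ and S_{≺P} ⊭ (Λ‖C)τ
    ∃ cl ∈ N, ∃ ys, cl.head = some (P, ys) ∧
      (∀ (β : V → U), ∀ b ∈ cl.body,
        litLt precP precU (false, b.1, b.2.map β) (true, P, ys.map β)) ∧
      ∃ τ : V → U, ys.map τ = as ∧ ¬ satg (SltP P) cl τ := by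
  have hDeltaC : ∀ {cl R ys Q bs}, cl.head = some (R, ys) → DeltaC cl Q bs →
      headMaximal precP precU cl ∧ deltaOp (SltP R) cl Q bs := by
    intro cl R ys Q bs hhead hcl
    have hprod : headMaximal precP precU cl ∧ ¬ sat (SltP R) cl := by
      by_contra hno
      refine hDeltaCbot cl (fun R' ys' hhead' => ?_) Q bs hcl
      obtain ⟨rfl, rfl⟩ := Prod.mk.inj (Option.some.inj (hhead.symm.trans hhead'))
      exact hno
    exact ⟨hprod.1, hDeltaCpos cl R ys hhead hprod.1 hprod.2 ▸ hcl⟩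
  have hDelta_pred : ∀ {R Q bs}, Delta R Q bs → R = Q := by
    intro R Q bs hR
    obtain ⟨cl, -, ⟨ys, hhead⟩, hcl⟩ := (hDelta R Q bs).1 hR
    obtain ⟨-, k, hk, hkQ, -⟩ := hDeltaC hhead hcl
    obtain rfl : k = (R, ys) := Option.some.inj (hk.symm.trans hhead)
    exact hkQ
  have hSlt_empty : ∀ bs, ¬ SltP P P bs := by
    intro bs hbs
    obtain ⟨R, hRP, hR⟩ := (hSlt P P bs).1 hbs
    obtain rfl := hDelta_pred hR
    exact hwfP.irrefl.irrefl _ hRP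
  obtain ⟨cl, hclN, ⟨ys, hhead⟩, hcl⟩ :=
    (hDelta P P as).1 (((hSle P P as).1 h).resolve_left (hSlt_empty as))
  obtain ⟨hmax, k, hk, -, τ, hτ, hconstr, hbody⟩ := hDeltaC hhead hcl
  obtain rfl : k = (P, ys) := Option.some.inj (hk.symm.trans hhead)
  refine ⟨cl, hclN, ys, hhead,
    fun β b hb => Or.inl (precP_of_headMaximal htotP hhead hmax hb), τ, hτ, fun hsat => ?_⟩
  rcases hsat hconstr with ⟨b, hb, hnb⟩ | ⟨k, hk, htrue⟩
  · exact hnb (hbody b hb)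
  · obtain rfl : k = (P, ys) := Option.some.inj (hk.symm.trans hhead)
    exact hSlt_empty _ htrue

end Stmt3
end

section
/- Let P ≺ Q ⪯ R be predicate symbols and let P be the maximal predicate of a clause C. If S_{⪯P} ⊨ Λ‖C or S_{≺Q} ⊨ Λ‖C, then S_{≺R} ⊨ Λ‖C and S_{⪯R} ⊨ Λ‖C. -/
/-!
STATEMENT 5: Let P ≺ Q ⪯ R be predicate symbols and let P be the maximal predicate
of a clause C.  If S_{⪯P} ⊨ Λ‖C or S_{≺Q} ⊨ Λ‖C, then S_{≺R} ⊨ Λ‖C and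
S_{⪯R} ⊨ Λ‖C.
-/

namespace Stmt5

/-- An interpretation assigns to each predicate symbol a set of argument tuples over
the universe `U`.  A symbolic interpretation S (an LA formula P^S(x⃗) for each
predicate) is identified with its corresponding interpretation I_S, i.e. it is
represented by the solution sets of the formulas P^S. -/
abbrev Interp (Pred U : Type) := Pred → List U → Prop

/-- A constrained Horn clause Λ‖C: a constraint Λ (a multiset of LA atoms,
represented semantically by its truth value under every assignment β : V → U),
a body of negative first-order literals ¬P₁(y⃗₁) ∨ … ∨ ¬P_m(y⃗_m) and an optional
positive head literal P(y⃗); all first-order arguments are variables. -/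
structure HClause (Pred V U : Type) where
  constraint : (V → U) → Prop
  body : List (Pred × List V)
  head : Option (Pred × List V)

/-- A ground literal: polarity (`true` = positive), predicate, ground arguments. -/
abbrev GLit (Pred U : Type) := Bool × Pred × List U

variable {Pred V U : Type}

/-- The predicate-based order on ground literals generated from the order `precP`
on predicate symbols and the order `precU` on the universe: predicates are
compared first, then polarity (positive smaller than negative over the same
predicate, independent of arguments), then arguments lexicographically. -/
def litLt (precP : Pred → Pred → Prop) (precU : U → U → Prop) :
    GLit Pred U → GLit Pred U → Prop := fun L L' =>
  precP L.2.1 L'.2.1 ∨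
    (L.2.1 = L'.2.1 ∧
      ((L.1 = true ∧ L'.1 = false) ∨ (L.1 = L'.1 ∧ List.Lex precU L.2.2 L'.2.2)))

/-- The (non-ground) literals of a Horn clause. -/
def lits (cl : HClause Pred V U) : List (Bool × Pred × List V) :=
  cl.body.map (fun b => (false, b.1, b.2)) ++
    (cl.head.map (fun h => (true, h.1, h.2))).toList

/-- The ground instance of a literal under the grounding substitution `β`. -/
def glit (L : Bool × Pred × List V) (β : V → U) : GLit Pred U :=
  (L.1, L.2.1, L.2.2.map β)

/-- Satisfaction of the ground instance (Λ‖C)β by the interpretation `I`: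
if the constraint is true under β then some ground literal of Cβ is true in `I`. -/
def satg (I : Interp Pred U) (cl : HClause Pred V U) (β : V → U) : Prop :=
  cl.constraint β →
    ((∃ b ∈ cl.body, ¬ I b.1 (b.2.map β)) ∨
      (∃ h, cl.head = some h ∧ I h.1 (h.2.map β)))

/-- I ⊨ Λ‖C : all ground instances are satisfied. -/
def sat (I : Interp Pred U) (cl : HClause Pred V U) : Prop := ∀ β, satg I cl β

/-- The literal L is ≺-maximal in the clause: there is a grounding substitution β
such that no different literal L' of the clause satisfies Lβ ≺ L'β. -/
def maximalIn (precP : Pred → Pred → Prop) (precU : U → U → Prop)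
    (L : Bool × Pred × List V) (cl : HClause Pred V U) : Prop :=
  L ∈ lits cl ∧ ∃ β : V → U, ∀ L' ∈ lits cl, L' ≠ L →
    ¬ litLt precP precU (glit L β) (glit L' β)

/-- The predicate P is ≺-maximal in the clause: some literal [¬]P(∗) of the clause
is ≺-maximal in it. -/
def predMaximalIn (precP : Pred → Pred → Prop) (precU : U → U → Prop)
    (P : Pred) (cl : HClause Pred V U) : Prop :=
  ∃ L, L.2.1 = P ∧ maximalIn precP precU L cl

/-- The positive head literal P(y⃗) is ≺-maximal in the clause. -/
def headMaximal (precP : Pred → Pred → Prop) (precU : U → U → Prop)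
    (cl : HClause Pred V U) : Prop :=
  ∃ h, cl.head = some h ∧ maximalIn precP precU (true, h.1, h.2) cl

/-- The operator δ(S, Λ‖C'∨P(y⃗)): it interprets the head predicate P by the
solution set of the formula (π({y⃗}, ⋀_{λ∈Λ} λ ∧ ⋀_i (P_i^S)σ_i))σ ∧ ⋎(y⃗,x⃗),
i.e. by the set of all tuples y⃗τ where the assignment τ solves Λ and makes every
body atom P_i(y⃗_i) true in S; every other predicate is interpreted as ⊥. -/
def deltaOp (S : Interp Pred U) (cl : HClause Pred V U) : Interp Pred U :=
  fun Q as =>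
    ∃ h, cl.head = some h ∧ h.1 = Q ∧
      ∃ τ : V → U, h.2.map τ = as ∧ cl.constraint τ ∧
        ∀ b ∈ cl.body, S b.1 (b.2.map τ)

/-- Satisfaction of a clause depends only on the predicates occurring in it. -/
theorem sat_congr {I J : Interp Pred U} {cl : HClause Pred V U}
    (hIJ : ∀ L ∈ lits cl, ∀ as, I L.2.1 as ↔ J L.2.1 as) : sat I cl ↔ sat J cl := by
  have hbody : ∀ b ∈ cl.body, ∀ as, I b.1 as ↔ J b.1 as := fun b hb =>
    hIJ (false, b.1, b.2) (List.mem_append_left _ (List.mem_map.2 ⟨b, hb, rfl⟩))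
  have hhead : ∀ h, cl.head = some h → ∀ as, I h.1 as ↔ J h.1 as := fun h hh =>
    hIJ (true, h.1, h.2) (List.mem_append_right _ (by simp [hh]))
  refine forall_congr' fun β => imp_congr_right fun _ => or_congr ?_ ?_
  · exact exists_congr fun b => and_congr_right fun hb => not_congr (hbody b hb _)
  · exact exists_congr fun h => and_congr_right fun hh => hhead h hh _

/-- A maximal predicate of a clause dominates every predicate of the clause. -/
theorem predMaximalIn.le {precP : Pred → Pred → Prop} {precU : U → U → Prop}
    (htotP : ∀ a b : Pred, precP a b ∨ a = b ∨ precP b a)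
    {P : Pred} {cl : HClause Pred V U} (hmax : predMaximalIn precP precU P cl) :
    ∀ L ∈ lits cl, precP L.2.1 P ∨ L.2.1 = P := by
  obtain ⟨M, rfl, -, β, hβ⟩ := hmax
  intro L hL
  by_cases hLM : L = M
  · exact Or.inr (by rw [hLM])
  · rcases htotP L.2.1 M.2.1 with h | h | h
    · exact Or.inl h
    · exact Or.inr h
    · exact absurd (Or.inl h) (hβ L hL hLM)

/-- A well-founded trichotomous relation is transitive. -/
theorem trans_of_wellFounded_of_trichotomous {α : Type*} {r : α → α → Prop}
    (hwf : WellFounded r) (htot : ∀ a b, r a b ∨ a = b ∨ r b a) {a b c : α}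
    (hab : r a b) (hbc : r b c) : r a c := by
  rcases htot a c with h | rfl | h
  · exact h
  · exact absurd hbc (hwf.asymmetric _ _ hab)
  · exact absurd h (hwf.asymmetric₃ _ _ _ hab hbc)

theorem sat_persists_upward
    (precP : Pred → Pred → Prop) (precU : U → U → Prop)
    -- ≺ is generated from total, well-founded, strict orders on predicates and on U
    (hwfP : WellFounded precP) (hwfU : WellFounded precU)
    (htotP : ∀ a b : Pred, precP a b ∨ a = b ∨ precP b a)
    (htotU : ∀ a b : U, precU a b ∨ a = b ∨ precU b a)
    -- N is a set of constrained Horn clauses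
    (N : Set (HClause Pred V U))
    -- the model construction: S_{≺P}, S_{⪯P}, Δ_P and Δ_P^{Λ‖C},
    -- defined by mutual induction over ≺
    (SltP SleP Delta : Pred → Interp Pred U)
    (DeltaC : HClause Pred V U → Interp Pred U)
    -- S_{≺P} = ⋃_{Q ≺ P} Δ_Q
    (hSlt : ∀ P Q as, SltP P Q as ↔ ∃ R, precP R P ∧ Delta R Q as)
    -- S_{⪯P} = S_{≺P} ∪ Δ_P
    (hSle : ∀ P Q as, SleP P Q as ↔ (SltP P Q as ∨ Delta P Q as))
    -- Δ_P = ⋃_{Λ‖C'∨P(∗) ∈ N} Δ_P^{Λ‖C'∨P(∗)}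
    (hDelta : ∀ P Q as, Delta P Q as ↔
      ∃ cl ∈ N, (∃ ys, cl.head = some (P, ys)) ∧ DeltaC cl Q as)
    -- Δ_P^{Λ‖C} = δ(S_{≺P}, Λ‖C) if P(y⃗) is maximal in C and S_{≺P} ⊭ Λ‖C ...
    (hDeltaCpos : ∀ cl P ys, cl.head = some (P, ys) →
      headMaximal precP precU cl → ¬ sat (SltP P) cl →
      DeltaC cl = deltaOp (SltP P) cl)
    -- ... and Δ_P^{Λ‖C} is the bottom symbolic interpretation otherwise
    (hDeltaCbot : ∀ cl,
      (∀ P ys, cl.head = some (P, ys) →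
        ¬ (headMaximal precP precU cl ∧ ¬ sat (SltP P) cl)) →
      ∀ Q as, ¬ DeltaC cl Q as)
    -- predicate symbols with P ≺ Q ⪯ R
    (P Q R : Pred) (hPQ : precP P Q) (hQR : precP Q R ∨ Q = R)
    -- a clause Λ‖C with maximal predicate P
    (cl : HClause Pred V U) (hmax : predMaximalIn precP precU P cl)
    -- S_{⪯P} ⊨ Λ‖C or S_{≺Q} ⊨ Λ‖C
    (h : sat (SleP P) cl ∨ sat (SltP Q) cl) :
    -- then S_{≺R} ⊨ Λ‖C and S_{⪯R} ⊨ Λ‖C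
    sat (SltP R) cl ∧ sat (SleP R) cl := by
  have delta_pred : ∀ P Q as, Delta P Q as → Q = P := by
    intro P Q as hd
    obtain ⟨c, -, ⟨ys, hys⟩, hc⟩ := (hDelta P Q as).1 hd
    by_cases hprod : headMaximal precP precU c ∧ ¬ sat (SltP P) c
    · rw [hDeltaCpos c P ys hys hprod.1 hprod.2] at hc
      obtain ⟨h, hh, rfl, -⟩ := hc
      rw [hys, Option.some.injEq] at hh
      rw [← hh]
    · refine absurd hc (hDeltaCbot c (fun P' ys' h' => ?_) Q as)
      rw [hys, Option.some.injEq, Prod.mk.injEq] at h'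
      rwa [← h'.1]
  have slt_iff : ∀ {A B : Pred}, precP B A → ∀ as, SltP A B as ↔ Delta B B as := by
    intro A B hBA as
    rw [hSlt]
    refine ⟨?_, fun hd => ⟨B, hBA, hd⟩⟩
    rintro ⟨C, -, hd⟩
    rwa [← delta_pred C B as hd] at hd
  have sle_iff : ∀ {A B : Pred}, precP B A ∨ B = A → ∀ as, SleP A B as ↔ Delta B B as := by
    intro A B hBA as
    rw [hSle]
    constructor
    · rintro (hs | hd)
      · obtain ⟨C, -, hd⟩ := (hSlt A B as).1 hs
        rwa [← delta_pred C B as hd] at hd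
      · rwa [← delta_pred A B as hd] at hd
    · intro hd
      rcases hBA with hBA | rfl
      · exact Or.inl ((slt_iff hBA as).2 hd)
      · exact Or.inr hd
  have hle := hmax.le htotP
  have hltQ : ∀ L ∈ lits cl, precP L.2.1 Q := by
    intro L hL
    rcases hle L hL with h' | h'
    · exact trans_of_wellFounded_of_trichotomous hwfP htotP h' hPQ
    · rwa [h']
  have hltR : ∀ L ∈ lits cl, precP L.2.1 R := by
    intro L hL
    rcases hQR with h' | rfl
    · exact trans_of_wellFounded_of_trichotomous hwfP htotP (hltQ L hL) h'
    · exact hltQ L hL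
  have hdiag : sat (fun B => Delta B B) cl := by
    rcases h with h | h
    · exact (sat_congr fun L hL as => sle_iff (hle L hL) as).1 h
    · exact (sat_congr fun L hL as => slt_iff (hltQ L hL) as).1 h
  exact ⟨(sat_congr fun L hL as => slt_iff (hltR L hL) as).2 hdiag,
    (sat_congr fun L hL as => sle_iff (Or.inl (hltR L hL)) as).2 hdiag⟩

end Stmt5
end

section
/- Let P ≺ Q ⪯ R be predicate symbols, [¬]P(x⃗) a literal over P and σ a grounding substitution. If S_{⪯P} ⊨ ([¬]P(x⃗))σ or S_{≺Q} ⊨ ([¬]P(x⃗))σ, then S_{≺R} ⊨ ([¬]P(x⃗))σ and S_{⪯R} ⊨ ([¬]P(x⃗))σ. -/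
/-!
STATEMENT 7: Let P ≺ Q ⪯ R be predicate symbols, [¬]P(x⃗) a literal over P and σ a
grounding substitution.  If S_{⪯P} ⊨ ([¬]P(x⃗))σ or S_{≺Q} ⊨ ([¬]P(x⃗))σ, then
S_{≺R} ⊨ ([¬]P(x⃗))σ and S_{⪯R} ⊨ ([¬]P(x⃗))σ.
-/

namespace Stmt7

/-- An interpretation assigns to each predicate symbol a set of argument tuples over
the universe `U`.  A symbolic interpretation S (an LA formula P^S(x⃗) for each
predicate) is identified with its corresponding interpretation I_S, i.e. it is
represented by the solution sets of the formulas P^S. -/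
abbrev Interp (Pred U : Type) := Pred → List U → Prop

/-- A constrained Horn clause Λ‖C: a constraint Λ (a multiset of LA atoms,
represented semantically by its truth value under every assignment β : V → U),
a body of negative first-order literals ¬P₁(y⃗₁) ∨ … ∨ ¬P_m(y⃗_m) and an optional
positive head literal P(y⃗); all first-order arguments are variables. -/
structure HClause (Pred V U : Type) where
  constraint : (V → U) → Prop
  body : List (Pred × List V)
  head : Option (Pred × List V)

/-- A ground literal: polarity (`true` = positive), predicate, ground arguments. -/
abbrev GLit (Pred U : Type) := Bool × Pred × List U

variable {Pred V U : Type}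

/-- The predicate-based order on ground literals generated from the order `precP`
on predicate symbols and the order `precU` on the universe: predicates are
compared first, then polarity (positive smaller than negative over the same
predicate, independent of arguments), then arguments lexicographically. -/
def litLt (precP : Pred → Pred → Prop) (precU : U → U → Prop) :
    GLit Pred U → GLit Pred U → Prop := fun L L' =>
  precP L.2.1 L'.2.1 ∨
    (L.2.1 = L'.2.1 ∧
      ((L.1 = true ∧ L'.1 = false) ∨ (L.1 = L'.1 ∧ List.Lex precU L.2.2 L'.2.2)))

/-- The (non-ground) literals of a Horn clause. -/
def lits (cl : HClause Pred V U) : List (Bool × Pred × List V) :=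
  cl.body.map (fun b => (false, b.1, b.2)) ++
    (cl.head.map (fun h => (true, h.1, h.2))).toList

/-- The ground instance of a literal under the grounding substitution `β`. -/
def glit (L : Bool × Pred × List V) (β : V → U) : GLit Pred U :=
  (L.1, L.2.1, L.2.2.map β)

/-- Satisfaction of the ground instance (Λ‖C)β by the interpretation `I`:
if the constraint is true under β then some ground literal of Cβ is true in `I`. -/
def satg (I : Interp Pred U) (cl : HClause Pred V U) (β : V → U) : Prop :=
  cl.constraint β →
    ((∃ b ∈ cl.body, ¬ I b.1 (b.2.map β)) ∨
      (∃ h, cl.head = some h ∧ I h.1 (h.2.map β)))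

/-- I ⊨ Λ‖C : all ground instances are satisfied. -/
def sat (I : Interp Pred U) (cl : HClause Pred V U) : Prop := ∀ β, satg I cl β

/-- The literal L is ≺-maximal in the clause: there is a grounding substitution β
such that no different literal L' of the clause satisfies Lβ ≺ L'β. -/
def maximalIn (precP : Pred → Pred → Prop) (precU : U → U → Prop)
    (L : Bool × Pred × List V) (cl : HClause Pred V U) : Prop :=
  L ∈ lits cl ∧ ∃ β : V → U, ∀ L' ∈ lits cl, L' ≠ L →
    ¬ litLt precP precU (glit L β) (glit L' β)

/-- The predicate P is ≺-maximal in the clause: some literal [¬]P(∗) of the clause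
is ≺-maximal in it. -/
def predMaximalIn (precP : Pred → Pred → Prop) (precU : U → U → Prop)
    (P : Pred) (cl : HClause Pred V U) : Prop :=
  ∃ L, L.2.1 = P ∧ maximalIn precP precU L cl

/-- The positive head literal P(y⃗) is ≺-maximal in the clause. -/
def headMaximal (precP : Pred → Pred → Prop) (precU : U → U → Prop)
    (cl : HClause Pred V U) : Prop :=
  ∃ h, cl.head = some h ∧ maximalIn precP precU (true, h.1, h.2) cl

/-- The operator δ(S, Λ‖C'∨P(y⃗)): it interprets the head predicate P by the
solution set of the formula (π({y⃗}, ⋀_{λ∈Λ} λ ∧ ⋀_i (P_i^S)σ_i))σ ∧ ⋎(y⃗,x⃗),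
i.e. by the set of all tuples y⃗τ where the assignment τ solves Λ and makes every
body atom P_i(y⃗_i) true in S; every other predicate is interpreted as ⊥. -/
def deltaOp (S : Interp Pred U) (cl : HClause Pred V U) : Interp Pred U :=
  fun Q as =>
    ∃ h, cl.head = some h ∧ h.1 = Q ∧
      ∃ τ : V → U, h.2.map τ = as ∧ cl.constraint τ ∧
        ∀ b ∈ cl.body, S b.1 (b.2.map τ)

/-- Truth of a ground literal in an interpretation: a positive ground literal
P(a⃗) holds iff a⃗ ∈ P^I, a negative one ¬P(a⃗) holds iff a⃗ ∉ P^I. -/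
def satLit (I : Interp Pred U) (L : GLit Pred U) : Prop :=
  cond L.1 (I L.2.1 L.2.2) (¬ I L.2.1 L.2.2)

/-- A well-founded trichotomous relation is transitive. -/
theorem trans_of_wellFounded_of_trichotomous {α : Type*} {r : α → α → Prop}
    (hwf : WellFounded r) (htot : ∀ a b, r a b ∨ a = b ∨ r b a) {a b c : α}
    (hab : r a b) (hbc : r b c) : r a c := by
  rcases htot a c with h | rfl | h
  · exact h
  · exact (hwf.asymmetric _ _ hab hbc).elim
  · exact (hwf.asymmetric₃ _ _ _ hab hbc h).elim

/-- The operator δ interprets only the head predicate of the clause. -/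
theorem deltaOp_eq_head {S : Interp Pred U} {cl : HClause Pred V U} {P Q : Pred}
    {ys : List V} {as : List U} (hhead : cl.head = some (P, ys))
    (h : deltaOp S cl Q as) : Q = P := by
  obtain ⟨h', hh', rfl, -⟩ := h
  rw [hhead, Option.some.injEq] at hh'
  rw [← hh']

theorem literal_sat_persists_upward
    (precP : Pred → Pred → Prop) (precU : U → U → Prop)
    -- ≺ is generated from total, well-founded, strict orders on predicates and on U
    (hwfP : WellFounded precP) (hwfU : WellFounded precU)
    (htotP : ∀ a b : Pred, precP a b ∨ a = b ∨ precP b a)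
    (htotU : ∀ a b : U, precU a b ∨ a = b ∨ precU b a)
    -- N is a set of constrained Horn clauses
    (N : Set (HClause Pred V U))
    -- the model construction: S_{≺P}, S_{⪯P}, Δ_P and Δ_P^{Λ‖C},
    -- defined by mutual induction over ≺
    (SltP SleP Delta : Pred → Interp Pred U)
    (DeltaC : HClause Pred V U → Interp Pred U)
    -- S_{≺P} = ⋃_{Q ≺ P} Δ_Q
    (hSlt : ∀ P Q as, SltP P Q as ↔ ∃ R, precP R P ∧ Delta R Q as)
    -- S_{⪯P} = S_{≺P} ∪ Δ_P
    (hSle : ∀ P Q as, SleP P Q as ↔ (SltP P Q as ∨ Delta P Q as))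
    -- Δ_P = ⋃_{Λ‖C'∨P(∗) ∈ N} Δ_P^{Λ‖C'∨P(∗)}
    (hDelta : ∀ P Q as, Delta P Q as ↔
      ∃ cl ∈ N, (∃ ys, cl.head = some (P, ys)) ∧ DeltaC cl Q as)
    -- Δ_P^{Λ‖C} = δ(S_{≺P}, Λ‖C) if P(y⃗) is maximal in C and S_{≺P} ⊭ Λ‖C ...
    (hDeltaCpos : ∀ cl P ys, cl.head = some (P, ys) →
      headMaximal precP precU cl → ¬ sat (SltP P) cl →
      DeltaC cl = deltaOp (SltP P) cl)
    -- ... and Δ_P^{Λ‖C} is the bottom symbolic interpretation otherwise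
    (hDeltaCbot : ∀ cl,
      (∀ P ys, cl.head = some (P, ys) →
        ¬ (headMaximal precP precU cl ∧ ¬ sat (SltP P) cl)) →
      ∀ Q as, ¬ DeltaC cl Q as)
    -- predicate symbols with P ≺ Q ⪯ R
    (P Q R : Pred) (hPQ : precP P Q) (hQR : precP Q R ∨ Q = R)
    -- a literal [¬]P(x⃗) over P (polarity s) and a grounding substitution σ
    (s : Bool) (xs : List V) (σ : V → U)
    -- S_{⪯P} ⊨ ([¬]P(x⃗))σ or S_{≺Q} ⊨ ([¬]P(x⃗))σ
    (h : satLit (SleP P) (s, P, xs.map σ) ∨ satLit (SltP Q) (s, P, xs.map σ)) :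
    -- then S_{≺R} ⊨ ([¬]P(x⃗))σ and S_{⪯R} ⊨ ([¬]P(x⃗))σ
    satLit (SltP R) (s, P, xs.map σ) ∧ satLit (SleP R) (s, P, xs.map σ) := by
  have hDelta_eq : ∀ {X Y as}, Delta X Y as → Y = X := by
    intro X Y as hX
    obtain ⟨cl, -, ⟨ys, hhead⟩, hcl⟩ := (hDelta X Y as).1 hX
    by_cases hm : headMaximal precP precU cl ∧ ¬ sat (SltP X) cl
    · rw [hDeltaCpos cl X ys hhead hm.1 hm.2] at hcl
      exact deltaOp_eq_head hhead hcl
    · refine (hDeltaCbot cl (fun X' ys' hhead' => ?_) Y as hcl).elim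
      obtain ⟨rfl, -⟩ : X = X' ∧ ys = ys' := by simpa [hhead] using hhead'
      exact hm
  have hSlt_iff : ∀ {X}, precP P X → ∀ as, SltP X P as ↔ Delta P P as := by
    intro X hPX as
    refine (hSlt X P as).trans ⟨?_, fun hd => ⟨P, hPX, hd⟩⟩
    rintro ⟨Y, -, hY⟩
    obtain rfl := hDelta_eq hY
    exact hY
  have hSle_self : ∀ as, SleP P P as ↔ Delta P P as := by
    intro as
    refine (hSle P P as).trans ⟨?_, Or.inr⟩
    rintro (hlt | hd)
    · obtain ⟨Y, -, hY⟩ := (hSlt P P as).1 hlt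
      obtain rfl := hDelta_eq hY
      exact hY
    · exact hd
  have hPR : precP P R := by
    rcases hQR with hQR | rfl
    · exact trans_of_wellFounded_of_trichotomous hwfP htotP hPQ hQR
    · exact hPQ
  have hSle_R : ∀ as, SleP R P as ↔ Delta P P as := by
    intro as
    refine (hSle R P as).trans ⟨?_, fun hd => Or.inl ((hSlt_iff hPR as).2 hd)⟩
    rintro (hlt | hd)
    · exact (hSlt_iff hPR as).1 hlt
    · obtain rfl := hDelta_eq hd
      exact hd
  simp only [satLit, hSle_self, hSle_R, hSlt_iff hPQ, hSlt_iff hPR, or_self, and_self] at h ⊢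
  exact h

end Stmt7
end

section
/- Let Λ_D‖D be a constrained Horn clause with D = D' ∨ P(y⃗). If Λ_D‖D produces P(y⃗)τ, then for every grounding substitution σ with S_{≺P} ⊭ (Λ_D‖D')σ and every predicate symbol Q with P ⪯ Q, it holds that S_{⪯Q} ⊭ (Λ_D‖D')σ. -/
/-!
STATEMENT 8: Let Λ_D‖D be a constrained Horn clause with D = D′ ∨ P(y⃗).  If Λ_D‖D
produces P(y⃗)τ, then for every grounding substitution σ with S_{≺P} ⊭ (Λ_D‖D′)σ and
every predicate symbol Q with P ⪯ Q, it holds that S_{⪯Q} ⊭ (Λ_D‖D′)σ.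
-/

namespace Stmt8

/-- An interpretation assigns to each predicate symbol a set of argument tuples over
the universe `U`.  A symbolic interpretation S (an LA formula P^S(x⃗) for each
predicate) is identified with its corresponding interpretation I_S, i.e. it is
represented by the solution sets of the formulas P^S. -/
abbrev Interp (Pred U : Type) := Pred → List U → Prop

/-- A constrained Horn clause Λ‖C: a constraint Λ (a multiset of LA atoms,
represented semantically by its truth value under every assignment β : V → U),
a body of negative first-order literals ¬P₁(y⃗₁) ∨ … ∨ ¬P_m(y⃗_m) and an optional
positive head literal P(y⃗); all first-order arguments are variables. -/
structure HClause (Pred V U : Type) where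
  constraint : (V → U) → Prop
  body : List (Pred × List V)
  head : Option (Pred × List V)

/-- A ground literal: polarity (`true` = positive), predicate, ground arguments. -/
abbrev GLit (Pred U : Type) := Bool × Pred × List U

variable {Pred V U : Type}

/-- The predicate-based order on ground literals generated from the order `precP`
on predicate symbols and the order `precU` on the universe: predicates are
compared first, then polarity (positive smaller than negative over the same
predicate, independent of arguments), then arguments lexicographically. -/
def litLt (precP : Pred → Pred → Prop) (precU : U → U → Prop) :
    GLit Pred U → GLit Pred U → Prop := fun L L' =>
  precP L.2.1 L'.2.1 ∨
    (L.2.1 = L'.2.1 ∧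
      ((L.1 = true ∧ L'.1 = false) ∨ (L.1 = L'.1 ∧ List.Lex precU L.2.2 L'.2.2)))

/-- The (non-ground) literals of a Horn clause. -/
def lits (cl : HClause Pred V U) : List (Bool × Pred × List V) :=
  cl.body.map (fun b => (false, b.1, b.2)) ++
    (cl.head.map (fun h => (true, h.1, h.2))).toList

/-- The ground instance of a literal under the grounding substitution `β`. -/
def glit (L : Bool × Pred × List V) (β : V → U) : GLit Pred U :=
  (L.1, L.2.1, L.2.2.map β)

/-- Satisfaction of the ground instance (Λ‖C)β by the interpretation `I`:
if the constraint is true under β then some ground literal of Cβ is true in `I`. -/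
def satg (I : Interp Pred U) (cl : HClause Pred V U) (β : V → U) : Prop :=
  cl.constraint β →
    ((∃ b ∈ cl.body, ¬ I b.1 (b.2.map β)) ∨
      (∃ h, cl.head = some h ∧ I h.1 (h.2.map β)))

/-- I ⊨ Λ‖C : all ground instances are satisfied. -/
def sat (I : Interp Pred U) (cl : HClause Pred V U) : Prop := ∀ β, satg I cl β

/-- The literal L is ≺-maximal in the clause: there is a grounding substitution β
such that no different literal L' of the clause satisfies Lβ ≺ L'β. -/
def maximalIn (precP : Pred → Pred → Prop) (precU : U → U → Prop)
    (L : Bool × Pred × List V) (cl : HClause Pred V U) : Prop :=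
  L ∈ lits cl ∧ ∃ β : V → U, ∀ L' ∈ lits cl, L' ≠ L →
    ¬ litLt precP precU (glit L β) (glit L' β)

/-- The predicate P is ≺-maximal in the clause: some literal [¬]P(∗) of the clause
is ≺-maximal in it. -/
def predMaximalIn (precP : Pred → Pred → Prop) (precU : U → U → Prop)
    (P : Pred) (cl : HClause Pred V U) : Prop :=
  ∃ L, L.2.1 = P ∧ maximalIn precP precU L cl

/-- The positive head literal P(y⃗) is ≺-maximal in the clause. -/
def headMaximal (precP : Pred → Pred → Prop) (precU : U → U → Prop)
    (cl : HClause Pred V U) : Prop :=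
  ∃ h, cl.head = some h ∧ maximalIn precP precU (true, h.1, h.2) cl

/-- The operator δ(S, Λ‖C'∨P(y⃗)): it interprets the head predicate P by the
solution set of the formula (π({y⃗}, ⋀_{λ∈Λ} λ ∧ ⋀_i (P_i^S)σ_i))σ ∧ ⋎(y⃗,x⃗),
i.e. by the set of all tuples y⃗τ where the assignment τ solves Λ and makes every
body atom P_i(y⃗_i) true in S; every other predicate is interpreted as ⊥. -/
def deltaOp (S : Interp Pred U) (cl : HClause Pred V U) : Interp Pred U :=
  fun Q as =>
    ∃ h, cl.head = some h ∧ h.1 = Q ∧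
      ∃ τ : V → U, h.2.map τ = as ∧ cl.constraint τ ∧
        ∀ b ∈ cl.body, S b.1 (b.2.map τ)

/-- A trichotomous well-founded relation is transitive. -/
theorem trans_of_wellFounded_of_trichotomous {α : Type*} {r : α → α → Prop}
    (hwf : WellFounded r) (htri : ∀ a b, r a b ∨ a = b ∨ r b a) {a b c : α}
    (hab : r a b) (hbc : r b c) : r a c := by
  have hac : Relation.TransGen r a c := .tail (.single hab) hbc
  rcases htri a c with h | rfl | h
  · exact h
  · exact (hwf.transGen.irrefl.irrefl a hac).elim
  · exact (hwf.transGen.irrefl.irrefl a (hac.tail h)).elim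

theorem produced_body_stays_false
    (precP : Pred → Pred → Prop) (precU : U → U → Prop)
    -- ≺ is generated from total, well-founded, strict orders on predicates and on U
    (hwfP : WellFounded precP) (hwfU : WellFounded precU)
    (htotP : ∀ a b : Pred, precP a b ∨ a = b ∨ precP b a)
    (htotU : ∀ a b : U, precU a b ∨ a = b ∨ precU b a)
    -- N is a set of constrained Horn clauses
    (N : Set (HClause Pred V U))
    -- the model construction: S_{≺P}, S_{⪯P}, Δ_P and Δ_P^{Λ‖C},
    -- defined by mutual induction over ≺
    (SltP SleP Delta : Pred → Interp Pred U)
    (DeltaC : HClause Pred V U → Interp Pred U)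
    -- S_{≺P} = ⋃_{Q ≺ P} Δ_Q
    (hSlt : ∀ P Q as, SltP P Q as ↔ ∃ R, precP R P ∧ Delta R Q as)
    -- S_{⪯P} = S_{≺P} ∪ Δ_P
    (hSle : ∀ P Q as, SleP P Q as ↔ (SltP P Q as ∨ Delta P Q as))
    -- Δ_P = ⋃_{Λ‖C'∨P(∗) ∈ N} Δ_P^{Λ‖C'∨P(∗)}
    (hDelta : ∀ P Q as, Delta P Q as ↔
      ∃ cl ∈ N, (∃ ys, cl.head = some (P, ys)) ∧ DeltaC cl Q as)
    -- Δ_P^{Λ‖C} = δ(S_{≺P}, Λ‖C) if P(y⃗) is maximal in C and S_{≺P} ⊭ Λ‖C ...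
    (hDeltaCpos : ∀ cl P ys, cl.head = some (P, ys) →
      headMaximal precP precU cl → ¬ sat (SltP P) cl →
      DeltaC cl = deltaOp (SltP P) cl)
    -- ... and Δ_P^{Λ‖C} is the bottom symbolic interpretation otherwise
    (hDeltaCbot : ∀ cl,
      (∀ P ys, cl.head = some (P, ys) →
        ¬ (headMaximal precP precU cl ∧ ¬ sat (SltP P) cl)) →
      ∀ Q as, ¬ DeltaC cl Q as)
    -- Λ_D‖D ∈ N with D = D′ ∨ P(y⃗)
    (clD : HClause Pred V U) (hclD : clD ∈ N)
    (P : Pred) (ys : List V) (hhead : clD.head = some (P, ys))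
    -- Λ_D‖D produces P(y⃗)τ, i.e. (y⃗τ) ∈ P^{Δ_P^{Λ_D‖D}}
    (τ : V → U) (hprod : DeltaC clD P (ys.map τ)) :
    -- then, for the subclause Λ_D‖D′ (the clause without its head literal):
    ∀ σ : V → U,
      ¬ satg (SltP P) { constraint := clD.constraint, body := clD.body, head := none } σ →
      ∀ Q, (P = Q ∨ precP P Q) →
        ¬ satg (SleP Q) { constraint := clD.constraint, body := clD.body, head := none } σ := by
  intro σ hσ Q hPQ hQ
  refine hσ fun hc => ?_
  obtain ⟨b, hb, hbQ⟩ | ⟨h, hh, -⟩ := hQ hc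
  · refine Or.inl ⟨b, hb, fun hbP => hbQ ((hSle _ _ _).2 (Or.inl ?_))⟩
    obtain rfl | hPQ := hPQ
    · exact hbP
    · obtain ⟨R, hRP, hR⟩ := (hSlt _ _ _).1 hbP
      exact (hSlt _ _ _).2
        ⟨R, trans_of_wellFounded_of_trichotomous hwfP htotP hRP hPQ, hR⟩
  · simp at hh

end Stmt8
end

section
/- Let Λ_C‖C ∈ N with C = C' ∨ ¬P(z⃗) where ¬P(z⃗) is maximal in C, let σ be a grounding with ¬P(z⃗)σ maximal in Cσ, and let Λ_D‖D ∈ N with D = D' ∨ P(y⃗), D' ≺ P(y⃗), be a clause (with variables disjoint from Λ_C‖C) producing P(z⃗)σ. Let σ' = mgu(P(z⃗), P(y⃗)) and let Λ_R‖R = (Λ_C,Λ_D‖C'∨D')σ' be the hierarchic resolvent, with τ' the substitution reconstructing the groundings. If R ≠ ⊥, then the ground resolvent (Λ_R‖R)τ' is strictly ≺-smaller than the ground clause (Λ_C‖C)σ. -/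
/-!
STATEMENT 14: Let Λ_C‖C ∈ N with C = C′ ∨ ¬P(z⃗) where ¬P(z⃗) is maximal in C, let
σ be a grounding with ¬P(z⃗)σ maximal in Cσ, and let Λ_D‖D ∈ N with D = D′ ∨ P(y⃗),
D′ ≺ P(y⃗), be a clause (with variables disjoint from Λ_C‖C) producing P(z⃗)σ.
Let σ′ = mgu(P(z⃗), P(y⃗)) and let Λ_R‖R = (Λ_C,Λ_D‖C′∨D′)σ′ be the hierarchic
resolvent, with τ′ the substitution reconstructing the groundings.  If R ≠ ⊥, then
the ground resolvent (Λ_R‖R)τ′ is strictly ≺-smaller than the ground clause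
(Λ_C‖C)σ.
-/

namespace Stmt14

/-- An interpretation assigns to each predicate symbol a set of argument tuples over
the universe `U`.  A symbolic interpretation S (an LA formula P^S(x⃗) for each
predicate) is identified with its corresponding interpretation I_S, i.e. it is
represented by the solution sets of the formulas P^S. -/
abbrev Interp (Pred U : Type) := Pred → List U → Prop

/-- A constrained Horn clause Λ‖C: a constraint Λ (a multiset of LA atoms,
represented semantically by its truth value under every assignment β : V → U),
a body of negative first-order literals ¬P₁(y⃗₁) ∨ … ∨ ¬P_m(y⃗_m) and an optional
positive head literal P(y⃗); all first-order arguments are variables. -/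
structure HClause (Pred V U : Type) where
  constraint : (V → U) → Prop
  body : List (Pred × List V)
  head : Option (Pred × List V)

/-- A ground literal: polarity (`true` = positive), predicate, ground arguments. -/
abbrev GLit (Pred U : Type) := Bool × Pred × List U

variable {Pred V U : Type}

/-- The predicate-based order on ground literals generated from the order `precP`
on predicate symbols and the order `precU` on the universe: predicates are
compared first, then polarity (positive smaller than negative over the same
predicate, independent of arguments), then arguments lexicographically. -/
def litLt (precP : Pred → Pred → Prop) (precU : U → U → Prop) :
    GLit Pred U → GLit Pred U → Prop := fun L L' =>
  precP L.2.1 L'.2.1 ∨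
    (L.2.1 = L'.2.1 ∧
      ((L.1 = true ∧ L'.1 = false) ∨ (L.1 = L'.1 ∧ List.Lex precU L.2.2 L'.2.2)))

/-- The (non-ground) literals of a Horn clause. -/
def lits (cl : HClause Pred V U) : List (Bool × Pred × List V) :=
  cl.body.map (fun b => (false, b.1, b.2)) ++
    (cl.head.map (fun h => (true, h.1, h.2))).toList

/-- The ground instance of a literal under the grounding substitution `β`. -/
def glit (L : Bool × Pred × List V) (β : V → U) : GLit Pred U :=
  (L.1, L.2.1, L.2.2.map β)

/-- Satisfaction of the ground instance (Λ‖C)β by the interpretation `I`: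
if the constraint is true under β then some ground literal of Cβ is true in `I`. -/
def satg (I : Interp Pred U) (cl : HClause Pred V U) (β : V → U) : Prop :=
  cl.constraint β →
    ((∃ b ∈ cl.body, ¬ I b.1 (b.2.map β)) ∨
      (∃ h, cl.head = some h ∧ I h.1 (h.2.map β)))

/-- I ⊨ Λ‖C : all ground instances are satisfied. -/
def sat (I : Interp Pred U) (cl : HClause Pred V U) : Prop := ∀ β, satg I cl β

/-- The literal L is ≺-maximal in the clause: there is a grounding substitution β
such that no different literal L' of the clause satisfies Lβ ≺ L'β. -/
def maximalIn (precP : Pred → Pred → Prop) (precU : U → U → Prop)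
    (L : Bool × Pred × List V) (cl : HClause Pred V U) : Prop :=
  L ∈ lits cl ∧ ∃ β : V → U, ∀ L' ∈ lits cl, L' ≠ L →
    ¬ litLt precP precU (glit L β) (glit L' β)

/-- The predicate P is ≺-maximal in the clause: some literal [¬]P(∗) of the clause
is ≺-maximal in it. -/
def predMaximalIn (precP : Pred → Pred → Prop) (precU : U → U → Prop)
    (P : Pred) (cl : HClause Pred V U) : Prop :=
  ∃ L, L.2.1 = P ∧ maximalIn precP precU L cl

/-- The positive head literal P(y⃗) is ≺-maximal in the clause. -/
def headMaximal (precP : Pred → Pred → Prop) (precU : U → U → Prop)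
    (cl : HClause Pred V U) : Prop :=
  ∃ h, cl.head = some h ∧ maximalIn precP precU (true, h.1, h.2) cl

/-- The operator δ(S, Λ‖C'∨P(y⃗)): it interprets the head predicate P by the
solution set of the formula (π({y⃗}, ⋀_{λ∈Λ} λ ∧ ⋀_i (P_i^S)σ_i))σ ∧ ⋎(y⃗,x⃗),
i.e. by the set of all tuples y⃗τ where the assignment τ solves Λ and makes every
body atom P_i(y⃗_i) true in S; every other predicate is interpreted as ⊥. -/
def deltaOp (S : Interp Pred U) (cl : HClause Pred V U) : Interp Pred U :=
  fun Q as =>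
    ∃ h, cl.head = some h ∧ h.1 = Q ∧
      ∃ τ : V → U, h.2.map τ = as ∧ cl.constraint τ ∧
        ∀ b ∈ cl.body, S b.1 (b.2.map τ)

/-- Application of a (variable-renaming) substitution σ to an atom Q(z⃗). -/
def substLit (σ : V → V) (b : Pred × List V) : Pred × List V := (b.1, b.2.map σ)

/-- σ is a most general unifier of the (first-order, variable-only) atoms P(z⃗)
and P(y⃗): it unifies them, and every unifier factors through it. -/
def IsMGU (zs ys : List V) (σ : V → V) : Prop :=
  zs.map σ = ys.map σ ∧
    ∀ (W : Type) (τ : V → W), zs.map τ = ys.map τ → ∃ ρ : V → W, ∀ v, τ v = ρ (σ v)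

/-- Hierarchic ≺-resolution on Horn clauses: from Λ₁‖C₁′ ∨ ¬P(z⃗) and
Λ₂‖C₂′ ∨ P(y⃗), where the resolved literals are ≺-maximal in their clauses and
σ = mgu(¬P(z⃗), comp(P(y⃗))), derive (Λ₁,Λ₂‖C₁′ ∨ C₂′)σ. -/
def ResStep [DecidableEq Pred] [DecidableEq V]
    (precP : Pred → Pred → Prop) (precU : U → U → Prop)
    (cl1 cl2 res : HClause Pred V U) : Prop :=
  ∃ (P : Pred) (zs ys : List V) (σ : V → V),
    (P, zs) ∈ cl1.body ∧
    maximalIn precP precU (false, P, zs) cl1 ∧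
    cl2.head = some (P, ys) ∧
    maximalIn precP precU (true, P, ys) cl2 ∧
    IsMGU zs ys σ ∧
    res = { constraint := fun β => cl1.constraint (β ∘ σ) ∧ cl2.constraint (β ∘ σ),
            body := (cl1.body.erase (P, zs) ++ cl2.body).map (substLit σ),
            head := cl1.head.map (substLit σ) }

/-- The multiset of ground literals of the ground instance (Λ‖C)β. -/
def gndLits (cl : HClause Pred V U) (β : V → U) : Multiset (GLit Pred U) :=
  Multiset.ofList (cl.body.map fun b => ((false : Bool), b.1, b.2.map β)) +
    Multiset.ofList ((cl.head.map fun h => ((true : Bool), h.1, h.2.map β)).toList)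

/-- The multiset extension of a relation `r`. -/
def MultisetExt {α : Type} (r : α → α → Prop) (M N : Multiset α) : Prop :=
  ∃ X Y Z, N = Z + X ∧ M = Z + Y ∧ X ≠ 0 ∧ ∀ y ∈ Y, ∃ x ∈ X, r y x

/-- The ground clause (Λ‖C)β is redundant w.r.t. the ground instances of N:
it is entailed by the ≺-smaller ground instances of clauses of N. -/
def RedundantG (precP : Pred → Pred → Prop) (precU : U → U → Prop)
    (N : Set (HClause Pred V U)) (cl : HClause Pred V U) (β : V → U) : Prop :=
  ∀ I : Interp Pred U,
    (∀ cl' ∈ N, ∀ β' : V → U,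
      MultisetExt (litLt precP precU) (gndLits cl' β') (gndLits cl β) →
      satg I cl' β') →
    satg I cl β

/-- A clause is redundant w.r.t. N if all its ground instances are redundant
w.r.t. the ground instances of N. -/
def Redundant (precP : Pred → Pred → Prop) (precU : U → U → Prop)
    (N : Set (HClause Pred V U)) (cl : HClause Pred V U) : Prop :=
  ∀ β : V → U, RedundantG precP precU N cl β

/-- N is saturated up to redundancy w.r.t. hierarchic ≺-resolution: every
resolution inference from clauses of N yields a clause that is contained in N or
redundant w.r.t. N. -/
def Saturated [DecidableEq Pred] [DecidableEq V]
    (precP : Pred → Pred → Prop) (precU : U → U → Prop)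
    (N : Set (HClause Pred V U)) : Prop :=
  ∀ cl1 ∈ N, ∀ cl2 ∈ N, ∀ res, ResStep precP precU cl1 cl2 res →
    res ∈ N ∨ Redundant precP precU N res

/-- The clause Λ‖C (with head P(y⃗)) produces the ground atom P(a⃗) via the
grounding τ: this unfolds a⃗ ∈ P^{Δ_P^{Λ‖C}} with δ-witness τ, i.e. P(y⃗) is
maximal in C, S_{≺P} ⊭ Λ‖C, y⃗τ = a⃗, Λτ holds and all body atoms are true in
S_{≺P} under τ. -/
def producesVia (precP : Pred → Pred → Prop) (precU : U → U → Prop)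
    (SltP : Pred → Interp Pred U) (cl : HClause Pred V U) (τ : V → U)
    (P : Pred) (as : List U) : Prop :=
  ∃ ys, cl.head = some (P, ys) ∧ ys.map τ = as ∧
    headMaximal precP precU cl ∧ ¬ sat (SltP P) cl ∧
    cl.constraint τ ∧ ∀ b ∈ cl.body, SltP P b.1 (b.2.map τ)

/-- The (first-order) variables occurring in a clause. -/
def varsOf (cl : HClause Pred V U) : Set V :=
  { v | (∃ b ∈ cl.body, v ∈ b.2) ∨ ∃ h, cl.head = some h ∧ v ∈ h.2 }

theorem map_substLit_congr {σ' : V → V} {τ' β : V → U} (b : Pred × List V)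
    (h : ∀ v ∈ b.2, τ' (σ' v) = β v) :
    (substLit σ' b).2.map τ' = b.2.map β := by
  simpa [substLit] using h

/-- A negative ground literal below a positive literal over `P` has a predicate below `P`. -/
theorem precP_of_litLt_neg_pos {precP : Pred → Pred → Prop} {precU : U → U → Prop}
    {Q P : Pred} {as bs : List U}
    (h : litLt precP precU (false, Q, as) (true, P, bs)) : precP Q P := by
  simpa [litLt] using h

/-- The ground literals of a resolvent are those of the first premise without the resolved
literal, together with the body literals of the second premise. -/
theorem gndLits_resolvent [DecidableEq Pred] [DecidableEq V]
    (clC clD : HClause Pred V U) (c : (V → U) → Prop) (a : Pred × List V)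
    (σ τ τ' : V → U) (σ' : V → V)
    (hτC : ∀ v ∈ varsOf clC, τ' (σ' v) = σ v)
    (hτD : ∀ v ∈ varsOf clD, τ' (σ' v) = τ v) :
    gndLits { constraint := c,
              body := (clC.body.erase a ++ clD.body).map (substLit σ'),
              head := clC.head.map (substLit σ') } τ' =
      gndLits { clC with body := clC.body.erase a } σ +
        Multiset.ofList (clD.body.map fun b => ((false : Bool), b.1, b.2.map τ)) := by
  have hC : (clC.body.erase a).map
        (fun b => ((false : Bool), (substLit σ' b).1, (substLit σ' b).2.map τ')) =
      (clC.body.erase a).map fun b => ((false : Bool), b.1, b.2.map σ) :=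
    List.map_congr_left fun b hb => by
      rw [map_substLit_congr b fun v hv => hτC v (Or.inl ⟨b, List.mem_of_mem_erase hb, hv⟩)]
      rfl
  have hD : clD.body.map
        (fun b => ((false : Bool), (substLit σ' b).1, (substLit σ' b).2.map τ')) =
      clD.body.map fun b => ((false : Bool), b.1, b.2.map τ) :=
    List.map_congr_left fun b hb => by
      rw [map_substLit_congr b fun v hv => hτD v (Or.inl ⟨b, hb, hv⟩)]
      rfl
  have hH : clC.head.map
        (fun h => ((true : Bool), (substLit σ' h).1, (substLit σ' h).2.map τ')) =
      clC.head.map fun h => ((true : Bool), h.1, h.2.map σ) :=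
    Option.map_congr fun h hh => by
      rw [map_substLit_congr h fun v hv => hτC v (Or.inr ⟨h, hh, hv⟩)]
      rfl
  simp only [gndLits, List.map_map, Option.map_map, List.map_append, Function.comp_def,
    hC, hD, hH, ← Multiset.coe_add]
  abel

theorem gndLits_eq_erase_add [DecidableEq Pred] [DecidableEq V]
    (cl : HClause Pred V U) {a : Pred × List V} (ha : a ∈ cl.body) (σ : V → U) :
    gndLits cl σ =
      gndLits { cl with body := cl.body.erase a } σ + {((false : Bool), a.1, a.2.map σ)} := by
  have h := Multiset.coe_eq_coe.mpr
    ((List.perm_cons_erase ha).map fun b => ((false : Bool), b.1, b.2.map σ))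
  simp only [gndLits, h, List.map_cons, ← Multiset.cons_coe, ← Multiset.singleton_add]
  abel

theorem ground_resolvent_smaller
    [DecidableEq Pred] [DecidableEq V]
    (precP : Pred → Pred → Prop) (precU : U → U → Prop)
    -- ≺ is generated from total, well-founded, strict orders on predicates and on U
    (hwfP : WellFounded precP) (hwfU : WellFounded precU)
    (htotP : ∀ a b : Pred, precP a b ∨ a = b ∨ precP b a)
    (htotU : ∀ a b : U, precU a b ∨ a = b ∨ precU b a)
    -- N is a set of constrained Horn clauses
    (N : Set (HClause Pred V U))
    -- the model construction: S_{≺P}, S_{⪯P}, Δ_P and Δ_P^{Λ‖C},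
    -- defined by mutual induction over ≺
    (SltP SleP Delta : Pred → Interp Pred U)
    (DeltaC : HClause Pred V U → Interp Pred U)
    -- S_{≺P} = ⋃_{Q ≺ P} Δ_Q
    (hSlt : ∀ P Q as, SltP P Q as ↔ ∃ R, precP R P ∧ Delta R Q as)
    -- S_{⪯P} = S_{≺P} ∪ Δ_P
    (hSle : ∀ P Q as, SleP P Q as ↔ (SltP P Q as ∨ Delta P Q as))
    -- Δ_P = ⋃_{Λ‖C'∨P(∗) ∈ N} Δ_P^{Λ‖C'∨P(∗)}
    (hDelta : ∀ P Q as, Delta P Q as ↔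
      ∃ cl ∈ N, (∃ ys, cl.head = some (P, ys)) ∧ DeltaC cl Q as)
    -- Δ_P^{Λ‖C} = δ(S_{≺P}, Λ‖C) if P(y⃗) is maximal in C and S_{≺P} ⊭ Λ‖C ...
    (hDeltaCpos : ∀ cl P ys, cl.head = some (P, ys) →
      headMaximal precP precU cl → ¬ sat (SltP P) cl →
      DeltaC cl = deltaOp (SltP P) cl)
    -- ... and Δ_P^{Λ‖C} is the bottom symbolic interpretation otherwise
    (hDeltaCbot : ∀ cl,
      (∀ P ys, cl.head = some (P, ys) →
        ¬ (headMaximal precP precU cl ∧ ¬ sat (SltP P) cl)) →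
      ∀ Q as, ¬ DeltaC cl Q as)
    -- Λ_C‖C ∈ N with C = C′ ∨ ¬P(z⃗), ¬P(z⃗) maximal in C
    (clC : HClause Pred V U) (hclC : clC ∈ N)
    (P : Pred) (zs : List V) (hzs : (P, zs) ∈ clC.body)
    (hmaxC : maximalIn precP precU (false, P, zs) clC)
    -- σ is a grounding with ¬P(z⃗)σ maximal in Cσ
    (σ : V → U)
    (hmaxCσ : ∀ L ∈ gndLits clC σ, L ≠ ((false : Bool), P, zs.map σ) →
      ¬ litLt precP precU ((false : Bool), P, zs.map σ) L)
    -- Λ_D‖D ∈ N with D = D′ ∨ P(y⃗) and D′ ≺ P(y⃗)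
    (clD : HClause Pred V U) (hclD : clD ∈ N)
    (ys : List V) (hheadD : clD.head = some (P, ys))
    (hbody_lt : ∀ (β : V → U), ∀ b ∈ clD.body,
      litLt precP precU (false, b.1, b.2.map β) (true, P, ys.map β))
    -- the variables of Λ_D‖D are disjoint from those of Λ_C‖C
    (hdisj : varsOf clC ∩ varsOf clD = ∅)
    -- Λ_D‖D produces P(z⃗)σ, via the grounding τ
    (τ : V → U) (hprod : producesVia precP precU SltP clD τ P (zs.map σ))
    -- σ′ = mgu(P(z⃗), P(y⃗))
    (σ' : V → V) (hmgu : IsMGU zs ys σ')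
    -- Λ_R‖R = (Λ_C,Λ_D‖C′∨D′)σ′ is the hierarchic resolvent
    (res : HClause Pred V U)
    (hres : res =
      { constraint := fun β => clC.constraint (β ∘ σ') ∧ clD.constraint (β ∘ σ'),
        body := (clC.body.erase (P, zs) ++ clD.body).map (substLit σ'),
        head := clC.head.map (substLit σ') })
    -- τ′ reconstructs the groundings: σ′τ′ agrees with σ on the variables of Λ_C‖C
    -- and with τ on the variables of Λ_D‖D
    (τ' : V → U)
    (hτC : ∀ v ∈ varsOf clC, τ' (σ' v) = σ v)
    (hτD : ∀ v ∈ varsOf clD, τ' (σ' v) = τ v)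
    -- R ≠ ⊥
    (hRne : ¬ (res.body = [] ∧ res.head = none)) :
    -- then (Λ_R‖R)τ′ ≺ (Λ_C‖C)σ
    MultisetExt (litLt precP precU) (gndLits res τ') (gndLits clC σ) := by
  subst hres
  refine ⟨{((false : Bool), P, zs.map σ)},
    Multiset.ofList (clD.body.map fun b => ((false : Bool), b.1, b.2.map τ)),
    gndLits { clC with body := clC.body.erase (P, zs) } σ,
    gndLits_eq_erase_add clC hzs σ,
    gndLits_resolvent clC clD _ (P, zs) σ τ τ' σ' hτC hτD,
    Multiset.singleton_ne_zero _, fun y hy => ⟨_, Multiset.mem_singleton_self _, ?_⟩⟩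
  obtain ⟨b, hb, rfl⟩ := List.mem_map.mp (Multiset.mem_coe.mp hy)
  exact Or.inl (precP_of_litLt_neg_pos (hbody_lt τ b hb))

end Stmt14
end
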